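/- Kurosh subgroup theorem: let (G_i)_{i ∈ I} be a family of groups, let G be their free product, and let H be a subgroup of G. Then there exist a subset X of G, an index set J, elements g_j ∈ G for j ∈ J, indices i_j ∈ I, and subgroups H_j ≤ G_{i_j} for j ∈ J, such that H is isomorphic to the free product of the free group on X with the free product of the conjugated subgroups g_j H_j g_j⁻¹. -/

import Mathlib

universe u v

open Monoid in
/-- Every element of a free product is a product of elements of the factors. -/
lemma kurosh_exists_list {I : Type u} (G : I → Type v) [∀ i, Group (G i)] (x : CoprodI G) :
    ∃ l : List (Σ i, G i), (l.map fun p => (CoprodI.of p.2 : CoprodI G)).prod = x := by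
  induction x using CoprodI.induction_on with
  | one => exact ⟨[], rfl⟩
  | of i m => exact ⟨[⟨i, m⟩], by simp⟩
  | mul x y hx hy =>
    obtain ⟨l, rfl⟩ := hx
    obtain ⟨l', rfl⟩ := hy
    exact ⟨l ++ l', by simp⟩

open Monoid in
/-- A distance function on the cosets. -/
lemma kurosh_length {I : Type u} (G : I → Type v) [∀ i, Group (G i)]
    {S : Type*} [MulAction (CoprodI G) S] (b : S) (hb : ∀ s, ∃ x : CoprodI G, x • b = s) :
    ∃ ℓ : S → ℕ, ∀ s, s ≠ b → ∃ (i : I) (g : G i) (s' : S),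
      s' = (CoprodI.of g : CoprodI G) • s ∧ ℓ s' < ℓ s := by
  classical
  have h1 : ∀ s, ∃ n, ∃ l : List (Σ i, G i), l.length = n ∧
      (l.map fun p => (CoprodI.of p.2 : CoprodI G)).prod • b = s := by
    intro s
    obtain ⟨x, rfl⟩ := hb s
    obtain ⟨l, rfl⟩ := kurosh_exists_list G x
    exact ⟨_, l, rfl, rfl⟩
  refine ⟨fun s => Nat.find (h1 s), fun s hs => ?_⟩
  obtain ⟨l, hl, hls⟩ := Nat.find_spec (h1 s)
  cases l with
  | nil => exact absurd (by simpa using hls.symm) hs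
  | cons p l =>
    refine ⟨p.1, p.2⁻¹, (l.map fun p => (CoprodI.of p.2 : CoprodI G)).prod • b, ?_, ?_⟩
    · rw [← hls]
      simp [mul_smul]
    · show Nat.find _ < Nat.find _
      rw [← hl]
      refine lt_of_le_of_lt (Nat.find_min' _ ⟨l, rfl, rfl⟩) ?_
      simp

open Monoid in
/-- The Kurosh system of transversals. -/
lemma kurosh_data {I : Type u} (G : I → Type v) [∀ i, Group (G i)]
    {S : Type*} [MulAction (CoprodI G) S] (b : S) (hb : ∀ s, ∃ x : CoprodI G, x • b = s) :
    ∃ (t : S → CoprodI G) (r : I → S → S) (γ : ∀ i, S → G i) (ℓ : S → ℕ),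
      (∀ s, t s • b = s) ∧ t b = 1 ∧
      (∀ i s, (CoprodI.of (γ i s) : CoprodI G) • r i s = s) ∧
      (∀ i (g : G i) s, r i ((CoprodI.of g : CoprodI G) • s) = r i s) ∧
      (∀ i s, γ i (r i s) = 1) ∧
      (∀ s, s ≠ b → ∃ i, ℓ (r i s) < ℓ s ∧ t s = CoprodI.of (γ i s) * t (r i s)) := by
  classical
  obtain ⟨ℓ, hℓ⟩ := kurosh_length G b hb
  have hm : ∀ O : Set S, ∃ m, O.Nonempty → m ∈ O ∧ ∀ x ∈ O, ℓ m ≤ ℓ x := by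
    intro O
    by_cases hO : O.Nonempty
    · obtain ⟨m, hm, hm'⟩ := (measure ℓ).wf.has_min O hO
      exact ⟨m, fun _ => ⟨hm, fun x hx => not_lt.1 (hm' x hx)⟩⟩
    · exact ⟨b, fun h => absurd h hO⟩
  choose m hm using hm
  let O : I → S → Set S := fun i s => {s' | ∃ g : G i, s' = (CoprodI.of g : CoprodI G) • s}
  have hO1 : ∀ i s, s ∈ O i s := fun i s => ⟨1, by simp⟩
  have hO : ∀ i (g : G i) s, O i ((CoprodI.of g : CoprodI G) • s) = O i s := by
    intro i g s
    ext s'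
    constructor
    · rintro ⟨k, rfl⟩
      exact ⟨k * g, by simp [mul_smul]⟩
    · rintro ⟨k, rfl⟩
      exact ⟨k * g⁻¹, by simp [mul_smul]⟩
  let r : I → S → S := fun i s => m (O i s)
  have hr : ∀ i (g : G i) s, r i ((CoprodI.of g : CoprodI G) • s) = r i s := by
    intro i g s
    simp only [r, hO]
  have hrm : ∀ i s, r i s ∈ O i s := fun i s => (hm _ ⟨s, hO1 i s⟩).1
  have hrl : ∀ i s, ∀ x ∈ O i s, ℓ (r i s) ≤ ℓ x := fun i s => (hm _ ⟨s, hO1 i s⟩).2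
  have hrr : ∀ i s, r i (r i s) = r i s := by
    intro i s
    obtain ⟨g, hg⟩ := hrm i s
    conv_lhs => rw [hg]
    exact hr i g s
  have hγ : ∀ i s, ∃ g : G i, (CoprodI.of g : CoprodI G) • r i s = s ∧ (r i s = s → g = 1) := by
    intro i s
    by_cases h : r i s = s
    · exact ⟨1, by simp [h], fun _ => rfl⟩
    · obtain ⟨g, hg⟩ := hrm i s
      exact ⟨g⁻¹, by rw [hg]; simp, fun h' => absurd h' h⟩
  choose γ hγ1 hγ2 using hγ
  have hi : ∀ s, s ≠ b → ∃ i, ℓ (r i s) < ℓ s := by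
    intro s hs
    obtain ⟨i, g, s', h1, h2⟩ := hℓ s hs
    exact ⟨i, lt_of_le_of_lt (hrl i s s' ⟨g, h1⟩) h2⟩
  choose ι hι using hi
  let F : ∀ s : S, (∀ s' : S, ℓ s' < ℓ s → CoprodI G) → CoprodI G := fun s ih =>
    if h : s = b then 1 else CoprodI.of (γ (ι s h) s) * ih (r (ι s h) s) (hι s h)
  let t : S → CoprodI G := (measure ℓ).wf.fix F
  have ht : ∀ s, t s = F s fun s' _ => t s' := fun s => WellFounded.fix_eq _ _ _
  have htb : t b = 1 := by
    rw [ht]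
    simp [F]
  have hts : ∀ s (h : s ≠ b), t s = CoprodI.of (γ (ι s h) s) * t (r (ι s h) s) := by
    intro s h
    rw [ht]
    simp [F, h]
  refine ⟨t, r, γ, ℓ, ?_, htb, hγ1, hr, fun i s => hγ2 _ _ (hrr i s),
    fun s h => ⟨ι s h, hι s h, hts s h⟩⟩
  intro s
  induction h : ℓ s using Nat.strong_induction_on generalizing s with
  | _ n ih =>
    by_cases hs : s = b
    · rw [hs, htb, one_smul]
    · rw [hts s hs, mul_smul, ih _ (h ▸ hι s hs) _ rfl, hγ1]

open Monoid in
/-- Extension of cocycles from the factors to the free product. -/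
lemma kurosh_cocycle {I : Type u} (G : I → Type v) [∀ i, Group (G i)]
    {S : Type*} [MulAction (CoprodI G) S] {A : Type*} [Group A]
    (c : ∀ i, G i → S → A)
    (hc : ∀ i (g g' : G i) s,
      c i (g * g') s = c i g ((CoprodI.of g' : CoprodI G) • s) * c i g' s) :
    ∃ C : CoprodI G → S → A, (∀ i g s, C (CoprodI.of g) s = c i g s) ∧
      ∀ x y s, C (x * y) s = C x (y • s) * C y s := by
  have hc1 : ∀ i s, c i 1 s = 1 := by
    intro i s
    have := hc i 1 1 s
    simpa using this
  let P : ∀ i, G i →* Function.End (S × A) := fun i =>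
    { toFun := fun g p => ((CoprodI.of g : CoprodI G) • p.1, c i g p.1 * p.2)
      map_one' := by
        funext p
        simp [hc1]
        rfl
      map_mul' := by
        intro g g'
        funext p
        show _ = ((CoprodI.of g : CoprodI G) • (CoprodI.of g' : CoprodI G) • p.1,
          c i g ((CoprodI.of g' : CoprodI G) • p.1) * (c i g' p.1 * p.2))
        simp [hc, mul_smul, mul_assoc] }
  let Q : CoprodI G →* Function.End (S × A) := CoprodI.lift P
  have hQo : ∀ i (g : G i) p, Q (CoprodI.of g) p =
      ((CoprodI.of g : CoprodI G) • p.1, c i g p.1 * p.2) := by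
    intro i g p
    simp only [Q, CoprodI.lift_of]
    rfl
  have hQm : ∀ x y p, Q (x * y) p = Q x (Q y p) := by
    intro x y p
    rw [map_mul]
    rfl
  have key : ∀ x s a, Q x (s, a) = (x • s, (Q x (s, 1)).2 * a) := by
    intro x
    induction x using CoprodI.induction_on with
    | one =>
      intro s a
      rw [map_one]
      show (s, a) = (_, 1 * a)
      simp
    | of i g =>
      intro s a
      simp [hQo]
    | mul x y hx hy =>
      intro s a
      rw [hQm, hQm, hy s a, hx, hy s 1, hx _ (_ * 1)]
      simp [mul_smul, mul_assoc]
  refine ⟨fun x s => (Q x (s, 1)).2, ?_, ?_⟩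
  · intro i g s
    simp [hQo]
  · intro x y s
    show (Q (x * y) (s, 1)).2 = _
    rw [hQm, key y s 1, key x]
    simp

/-- **Kurosh subgroup theorem.**  Every subgroup `H` of a free product
`G = ∗_{i ∈ I} G i` is isomorphic to a free product
`F(X) ∗ (∗_{j ∈ J} g j • (Hj j) • (g j)⁻¹)` of a free group on a subset `X`
of `G` with conjugates (by elements `g j ∈ G`) of subgroups `Hj j` of the
factors `G (idx j)`. -/
theorem kurosh_subgroup_theorem {I : Type u} (G : I → Type v)
    [∀ i, Group (G i)] (H : Subgroup (Monoid.CoprodI G)) :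
    ∃ (X : Set (Monoid.CoprodI G)) (J : Type (max u v))
      (g : J → Monoid.CoprodI G) (idx : J → I)
      (Hj : ∀ j : J, Subgroup (G (idx j))),
      Nonempty (H ≃*
        Monoid.Coprod (FreeGroup X)
          (Monoid.CoprodI fun j : J =>
            ((Hj j).map (Monoid.CoprodI.of)).map
              (MulAut.conj (g j)).toMonoidHom)) := by
  classical
  let S := Monoid.CoprodI G ⧸ H
  let b : S := ((1 : Monoid.CoprodI G) : S)
  have hb : ∀ s : S, ∃ x : Monoid.CoprodI G, x • b = s := by
    intro s
    obtain ⟨x, rfl⟩ := QuotientGroup.mk_surjective s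
    exact ⟨x, by show ((x * 1 : Monoid.CoprodI G) : S) = _; rw [mul_one]⟩
  have hbH : ∀ x : Monoid.CoprodI G, x • b = b ↔ x ∈ H := by
    intro x
    show ((x * 1 : Monoid.CoprodI G) : S) = ((1 : Monoid.CoprodI G) : S) ↔ _
    rw [mul_one, eq_comm, QuotientGroup.eq]
    simp
  obtain ⟨t, r, γ, ℓ, ht, htb, hγ, hr, hγr, hℓ⟩ := kurosh_data G b hb
  have hrr : ∀ i s, r i (r i s) = r i s := by
    intro i s
    conv_rhs => rw [← hγ i s, hr]
  -- the transversals for each factor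
  let τ : I → S → Monoid.CoprodI G := fun i s => Monoid.CoprodI.of (γ i s) * t (r i s)
  have hτr : ∀ i s, τ i (r i s) = t (r i s) := by
    intro i s
    simp [τ, hγr, hrr]
  have hτ : ∀ i s, τ i s • b = s := by
    intro i s
    simp only [τ, mul_smul, ht, hγ]
  let X : Set (Monoid.CoprodI G) := {x | x ≠ 1 ∧ ∃ i s, x = (t s)⁻¹ * τ i s}
  let J := {p : I × S // r p.1 p.2 = p.2}
  let gj : J → Monoid.CoprodI G := fun j => (t j.1.2)⁻¹
  let idx : J → I := fun j => j.1.1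
  let Hj : ∀ j : J, Subgroup (G (idx j)) := fun j =>
    (MulAction.stabilizer (Monoid.CoprodI G) j.1.2).comap Monoid.CoprodI.of
  refine ⟨X, J, gj, idx, Hj, ?_⟩
  let K : J → Subgroup (Monoid.CoprodI G) := fun j =>
    ((Hj j).map (Monoid.CoprodI.of)).map (MulAut.conj (gj j)).toMonoidHom
  have hK : ∀ j x, x ∈ K j ↔ ∃ g : G j.1.1, (Monoid.CoprodI.of g : Monoid.CoprodI G) • j.1.2 = j.1.2 ∧
      (t j.1.2)⁻¹ * Monoid.CoprodI.of g * t j.1.2 = x := by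
    intro j x
    simp [K, Hj, gj, idx, MulAction.mem_stabilizer_iff]
  let A := Monoid.Coprod (FreeGroup X) (Monoid.CoprodI fun j : J => K j)
  show Nonempty (H ≃* A)
  let ξ : Monoid.CoprodI G → A := fun x =>
    if h : x ∈ X then Monoid.Coprod.inl (FreeGroup.of ⟨x, h⟩) else 1
  let κ : J → Monoid.CoprodI G → A := fun j x =>
    if h : x ∈ K j then
      Monoid.Coprod.inr (Monoid.CoprodI.of (M := fun j : J => K j) (i := j) ⟨x, h⟩) else 1
  have hκm : ∀ j x y, x ∈ K j → y ∈ K j → κ j (x * y) = κ j x * κ j y := by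
    intro j x y hx hy
    simp only [κ, dif_pos hx, dif_pos hy, dif_pos (mul_mem hx hy)]
    rw [← map_mul, ← map_mul]
    rfl
  have hκ1 : ∀ j, κ j 1 = 1 := by
    intro j
    have := hκm j 1 1 (one_mem _) (one_mem _)
    simpa using this
  have hξ1 : ξ 1 = 1 := by simp [ξ, X]
  let rj : I → S → J := fun i s => ⟨(i, r i s), hrr i s⟩
  let d : ∀ i, G i → S → Monoid.CoprodI G := fun i g s =>
    (τ i ((Monoid.CoprodI.of g : Monoid.CoprodI G) • s))⁻¹ * Monoid.CoprodI.of g * τ i s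
  have hdK : ∀ i g s, d i g s ∈ K (rj i s) := by
    intro i g s
    rw [hK]
    refine ⟨(γ i ((Monoid.CoprodI.of g : Monoid.CoprodI G) • s))⁻¹ * g * γ i s, ?_, ?_⟩
    · show _ • r i s = r i s
      simp only [map_mul, map_inv, mul_smul, hγ]
      rw [inv_smul_eq_iff]
      rw [← hr i g s, hγ, hr, hγ]
    · simp [d, τ, rj, hr, mul_assoc]
  have hdm : ∀ i (g g' : G i) s,
      d i (g * g') s = d i g ((Monoid.CoprodI.of g' : Monoid.CoprodI G) • s) * d i g' s := by
    intro i g g' s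
    simp [d, mul_smul, mul_assoc]
  let χ : I → S → A := fun i s => ξ ((t s)⁻¹ * τ i s)
  obtain ⟨C, hC, hCm⟩ := kurosh_cocycle G (S := S) (A := A)
    (fun i g s => χ i ((Monoid.CoprodI.of g : Monoid.CoprodI G) • s) * κ (rj i s) (d i g s) *
      (χ i s)⁻¹) (by
      intro i g g' s
      have e : rj i ((Monoid.CoprodI.of g' : Monoid.CoprodI G) • s) = rj i s := by
        simp [rj, hr]
      have h1 := hdK i g ((Monoid.CoprodI.of g' : Monoid.CoprodI G) • s)
      rw [e] at h1
      rw [e, hdm, hκm _ _ _ h1 (hdK i g' s)]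
      simp only [map_mul, mul_smul, mul_assoc]
      rw [inv_mul_cancel_left])
  have hC1 : ∀ s, C 1 s = 1 := by
    intro s
    have := hCm 1 1 s
    simpa using this
  -- the map back
  let ψ : A →* Monoid.CoprodI G := Monoid.Coprod.lift (FreeGroup.lift fun x : X => (x : Monoid.CoprodI G))
    (Monoid.CoprodI.lift fun j : J => (K j).subtype)
  have hψξ : ∀ i s, ψ (χ i s) = (t s)⁻¹ * τ i s := by
    intro i s
    by_cases h : (t s)⁻¹ * τ i s ∈ X
    · simp only [χ, ξ, ψ, dif_pos h]
      exact (Monoid.Coprod.lift_apply_inl _ _ _).trans FreeGroup.lift_apply_of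
    · have h' : (t s)⁻¹ * τ i s = 1 := by
        by_contra h'
        exact h ⟨h', i, s, rfl⟩
      simp only [χ]
      rw [h', hξ1, map_one]
  have hψκ : ∀ j x, x ∈ K j → ψ (κ j x) = x := by
    intro j x hx
    simp only [κ, ψ, dif_pos hx]
    exact (Monoid.Coprod.lift_apply_inr _ _ _).trans (Monoid.CoprodI.lift_of _ _)
  have hψC : ∀ x s, ψ (C x s) = (t (x • s))⁻¹ * x * t s := by
    intro x
    induction x using Monoid.CoprodI.induction_on with
    | one => intro s; simp [hC1]
    | of i g =>
      intro s
      rw [hC, map_mul, map_mul, map_inv, hψξ, hψξ, hψκ _ _ (hdK i g s)]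
      simp [d, mul_assoc]
    | mul x y hx hy =>
      intro s
      rw [hCm, map_mul, hx, hy]
      simp [mul_smul, mul_assoc]
  -- cocycle on elementary moves
  have hCτ : ∀ i s, C (Monoid.CoprodI.of (γ i s)) (r i s) = χ i s := by
    intro i s
    have h1 : χ i (r i s) = 1 := by simp [χ, hτr, hξ1]
    have h2 : d i (γ i s) (r i s) = 1 := by
      simp only [d, hγ, hτr]
      simp [τ, mul_assoc]
    rw [hC, h1, h2, hκ1, hγ]
    simp
  have hCt : ∀ s, C (t s) b = 1 := by
    intro s
    induction h : ℓ s using Nat.strong_induction_on generalizing s with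
    | _ n ih =>
      by_cases hs : s = b
      · rw [hs, htb, hC1]
      · obtain ⟨i, hi, hi'⟩ := hℓ s hs
        have e : χ i s = 1 := by
          simp only [χ, τ]
          rw [← hi', inv_mul_cancel, hξ1]
        rw [hi', hCm, ht, hCτ, ih _ (h ▸ hi) _ rfl, e, mul_one]
  have hCtau : ∀ i s, C (τ i s) b = χ i s := by
    intro i s
    simp only [τ]
    rw [hCm, ht, hCτ, hCt, mul_one]
  have hCinv : ∀ s, C (t s)⁻¹ s = 1 := by
    intro s
    have := hCm (t s)⁻¹ (t s) b
    rw [inv_mul_cancel, hC1, ht, hCt, mul_one] at this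
    exact this.symm
  let φ : H →* A :=
    { toFun := fun h => C h b
      map_one' := hC1 b
      map_mul' := by
        intro x y
        have : (y : Monoid.CoprodI G) • b = b := (hbH _).2 y.2
        show C (x * y) b = _
        rw [hCm, this] }
  have hφ : ∀ x (hx : x ∈ H), φ ⟨x, hx⟩ = C x b := fun _ _ => rfl
  have hinj : Function.Injective φ := by
    intro x y hxy
    have h : ∀ z : H, ψ (φ z) = z := by
      intro z
      have hz : (z : Monoid.CoprodI G) • b = b := (hbH _).2 z.2
      show ψ (C z b) = z
      rw [hψC, hz, htb]
      simp
    exact Subtype.ext (by rw [← h x, ← h y, hxy])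
  have hX : ∀ x : X, Monoid.Coprod.inl (FreeGroup.of x) ∈ φ.range := by
    rintro ⟨x, hx⟩
    obtain ⟨hx1, i, s, rfl⟩ := id hx
    have hH : (t s)⁻¹ * τ i s ∈ H := by
      rw [← hbH, mul_smul, hτ, inv_smul_eq_iff, ht]
    refine ⟨⟨_, hH⟩, ?_⟩
    rw [hφ, hCm, hτ, hCinv, hCtau, one_mul]
    simp only [χ, ξ]
    rw [dif_pos hx]
  have hKr : ∀ (j : J) (x : K j), Monoid.Coprod.inr
      (Monoid.CoprodI.of (M := fun j : J => K j) (i := j) x) ∈ φ.range := by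
    rintro ⟨⟨i, s⟩, hj⟩ ⟨x, hx⟩
    obtain ⟨g, hg, rfl⟩ := (hK _ _).1 hx
    dsimp only at hg hj hx ⊢
    have hH : (t s)⁻¹ * Monoid.CoprodI.of g * t s ∈ H := by
      rw [← hbH, mul_smul, mul_smul, ht, hg, inv_smul_eq_iff, ht]
    refine ⟨⟨_, hH⟩, ?_⟩
    have hts : τ i s = t s := by rw [← hj, hτr]
    have h1 : χ i s = 1 := by simp [χ, hts, hξ1]
    have h2 : rj i s = ⟨(i, s), hj⟩ := by simp [rj, hj]
    have h3 : d i g s = (t s)⁻¹ * Monoid.CoprodI.of g * t s := by simp [d, hg, hts]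
    rw [hφ, hCm, ht, hCt, hCm, hg, hCinv, hC, hg, h1, h2, h3]
    simp only [κ, dif_pos hx]
    simp
  have hsurj : Function.Surjective φ := by
    intro a
    show a ∈ φ.range
    induction a using Monoid.Coprod.induction_on with
    | inl x =>
      induction x using FreeGroup.induction_on with
      | C1 => rw [map_one]; exact one_mem _
      | of x => exact hX x
      | inv_of x _ => rw [map_inv]; exact inv_mem (hX x)
      | mul x y hx hy => rw [map_mul]; exact mul_mem hx hy
    | inr x =>
      induction x using Monoid.CoprodI.induction_on with
      | one => rw [map_one]; exact one_mem _
      | of j x => exact hKr j x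
      | mul x y hx hy => rw [map_mul]; exact mul_mem hx hy
    | mul x y hx hy => exact mul_mem hx hy
  exact ⟨MulEquiv.ofBijective φ ⟨hinj, hsurj⟩⟩
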